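/- For every even integer k ≥ 4 there exist a constant C > 0 and Δ₀ such that for every integer Δ ≥ Δ₀, the independence polynomial of the k-uniform star S^k_Δ has a real zero λ with |λ| ≤ C·((log Δ)/Δ)^{1/(k−1)}. Consequently, for each even k ≥ 4 there is a family of k-uniform hypergraphs of maximum degree Δ whose smallest root λ satisfies |λ| = O(((log Δ)/Δ)^{1/(k−1)}). -/

import Mathlib

open Finset

/-- The (real) univariate independence polynomial of the hypergraph with vertex
type `V` and edge set `E`: the sum of `x ^ |I|` over all independent sets `I`. -/
noncomputable def indepPolyR {V : Type*} [Fintype V] [DecidableEq V]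
    (E : Finset (Finset V)) (x : ℝ) : ℝ :=
  ∑ I ∈ univ.powerset.filter (fun I => ∀ e ∈ E, ¬ e ⊆ I), x ^ I.card

/-- The generating polynomial of the subsets of a finite set, by cardinality. -/
theorem sum_powerset_pow_card {V : Type*} (A : Finset V) (x : ℝ) :
    ∑ J ∈ A.powerset, x ^ J.card = (1 + x) ^ A.card := by
  have h := Finset.sum_pow_mul_eq_add_pow x 1 A
  simpa [add_comm] using h

/-- The generating polynomial of the proper subsets of a finite set, by cardinality. -/
theorem sum_filter_not_subset_pow_card {V : Type*} [DecidableEq V] (A : Finset V) (x : ℝ) :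
    ∑ J ∈ A.powerset.filter (fun J => ¬ A ⊆ J), x ^ J.card
      = (1 + x) ^ A.card - x ^ A.card := by
  rw [← sum_powerset_pow_card, ← Finset.sum_filter_add_sum_filter_not A.powerset (fun J => A ⊆ J)]
  have : A.powerset.filter (fun J => A ⊆ J) = {A} := by
    ext J
    simp only [mem_filter, mem_powerset, mem_singleton]
    exact ⟨fun h => h.1.antisymm h.2, fun h => by simp [h]⟩
  rw [this]
  simp

/-- For pairwise disjoint sets, the sets in their union that contain none of them are counted by
a product. -/
theorem sum_filter_biUnion_pow_card {V ι : Type*} [DecidableEq V] [DecidableEq ι]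
    (A : ι → Finset V) (x : ℝ) (s : Finset ι)
    (hs : (s : Set ι).PairwiseDisjoint A) :
    ∑ J ∈ (s.biUnion A).powerset.filter (fun J => ∀ i ∈ s, ¬ A i ⊆ J), x ^ J.card
      = ∏ i ∈ s, ((1 + x) ^ (A i).card - x ^ (A i).card) := by
  induction s using Finset.induction_on with
  | empty => simp
  | insert a s ha ih =>
    rw [Finset.prod_insert ha, ← ih (hs.subset (by simp)), ← sum_filter_not_subset_pow_card,
      Finset.sum_mul_sum, ← Finset.sum_product']
    have hdis : ∀ i ∈ s, Disjoint (A a) (A i) := fun i hi =>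
      hs (by simp) (by simp [hi]) (fun h => ha (h ▸ hi))
    have hd : Disjoint (A a) (s.biUnion A) := by
      rw [Finset.disjoint_biUnion_right]
      exact hdis
    refine Finset.sum_nbij' (fun J => (J ∩ A a, J ∩ s.biUnion A)) (fun p => p.1 ∪ p.2) ?_ ?_ ?_ ?_ ?_
    · intro J hJ
      simp only [mem_filter, mem_powerset, mem_product] at hJ ⊢
      refine ⟨⟨inter_subset_right, fun h => hJ.2 a (by simp) (h.trans inter_subset_left)⟩,
        inter_subset_right, fun i hi h => hJ.2 i (by simp [hi]) (h.trans inter_subset_left)⟩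
    · rintro ⟨P, Q⟩ h
      simp only [mem_filter, mem_powerset, mem_product] at h ⊢
      obtain ⟨⟨hP, hP'⟩, hQ, hQ'⟩ := h
      refine ⟨?_, ?_⟩
      · rw [Finset.biUnion_insert]
        exact union_subset_union hP hQ
      · intro i hi hsub
        rcases Finset.mem_insert.1 hi with rfl | hi
        · exact hP' ((hd.mono_right hQ).left_le_of_le_sup_right hsub)
        · exact hQ' i hi (((hdis i hi).symm.mono_right hP).left_le_of_le_sup_left hsub)
    · intro J hJ
      simp only [mem_filter, mem_powerset, Finset.biUnion_insert] at hJ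
      rw [← Finset.inter_union_distrib_left]
      exact inter_eq_left.2 hJ.1
    · rintro ⟨P, Q⟩ h
      simp only [mem_filter, mem_powerset, mem_product] at h
      obtain ⟨⟨hP, -⟩, hQ, -⟩ := h
      have h1 : Q ∩ A a = ∅ := disjoint_iff_inter_eq_empty.1 (hd.symm.mono_left hQ)
      have h2 : P ∩ s.biUnion A = ∅ := disjoint_iff_inter_eq_empty.1 (hd.mono_left hP)
      simp only [union_inter_distrib_right, h1, h2, inter_eq_left.2 hP, inter_eq_left.2 hQ,
        union_empty, empty_union]
    · intro J hJ
      simp only [mem_filter, mem_powerset, Finset.biUnion_insert] at hJ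
      rw [← pow_add, ← card_union_of_disjoint (hd.mono inter_subset_right inter_subset_right),
        ← Finset.inter_union_distrib_left, inter_eq_left.2 hJ.1]

/-- The independence polynomial of the star with `d` edges of size `m + 1`. -/
theorem indepPolyR_star {V : Type*} [Fintype V] [DecidableEq V] (E : Finset (Finset V))
    (m : ℕ) (c : V) (hV : Fintype.card V = 1 + m * E.card)
    (hcard : ∀ e ∈ E, e.card = m + 1) (hc : ∀ e ∈ E, c ∈ e)
    (hE : ∀ e ∈ E, ∀ f ∈ E, e ≠ f → e ∩ f = {c}) (x : ℝ) :
    indepPolyR E x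
      = (1 + x) ^ (m * E.card) + x * ((1 + x) ^ m - x ^ m) ^ E.card := by
  have hA : ∀ e ∈ E, (e.erase c).card = m := fun e he => by
    rw [card_erase_of_mem (hc e he), hcard e he, Nat.add_sub_cancel]
  have hdis : (E : Set (Finset V)).PairwiseDisjoint (fun e => e.erase c) := by
    intro e he f hf hef
    rw [Function.onFun, Finset.disjoint_left]
    intro v hv hv'
    have : v ∈ e ∩ f := mem_inter.2 ⟨mem_of_mem_erase hv, mem_of_mem_erase hv'⟩
    rw [hE e he f hf hef, mem_singleton] at this
    exact ne_of_mem_erase hv this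
  have hun : E.biUnion (fun e => e.erase c) = univ.erase c := by
    apply eq_of_subset_of_card_le
    · intro v hv
      obtain ⟨e, -, he⟩ := mem_biUnion.1 hv
      simp [ne_of_mem_erase he]
    · rw [card_biUnion hdis, Finset.sum_congr rfl hA, card_erase_of_mem (mem_univ c), card_univ, hV]
      simp [mul_comm]
  have hcu : (univ.erase c).card = m * E.card := by
    rw [card_erase_of_mem (mem_univ c), card_univ, hV, Nat.add_sub_cancel_left]
  have hprod := sum_filter_biUnion_pow_card (fun e => e.erase c) x E hdis
  rw [hun, Finset.prod_congr rfl (fun e he => by rw [hA e he]), prod_const] at hprod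
  rw [indepPolyR, ← Finset.sum_filter_not_add_sum_filter _ (fun I => c ∈ I), ← hprod, ← hcu,
    ← sum_powerset_pow_card, Finset.mul_sum]
  congr 1
  · refine Finset.sum_congr ?_ fun _ _ => rfl
    ext I
    simp only [mem_filter, mem_powerset, subset_univ, true_and, subset_erase]
    exact ⟨fun h => h.2, fun h => ⟨fun e he hI => h (hI (hc e he)), h⟩⟩
  · refine Finset.sum_nbij' (fun I => I.erase c) (fun J => insert c J) ?_ ?_ ?_ ?_ ?_
    · intro I hI
      simp only [mem_filter, mem_powerset, subset_univ, true_and] at hI ⊢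
      refine ⟨erase_subset_erase _ (subset_univ _), fun e he h => hI.1 e he ?_⟩
      rw [← insert_erase hI.2, ← insert_erase (hc e he)]
      exact insert_subset_insert _ h
    · intro J hJ
      simp only [mem_filter, mem_powerset, subset_univ, true_and, subset_erase] at hJ ⊢
      refine ⟨fun e he h => hJ.2 e he ?_, mem_insert_self _ _⟩
      rwa [← subset_insert_iff]
    · intro I hI
      exact insert_erase (mem_filter.1 hI).2
    · intro J hJ
      simp only [mem_filter, mem_powerset, subset_erase] at hJ
      exact erase_insert hJ.1.2
    · intro I hI
      have h := (mem_filter.1 hI).2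
      rw [← card_erase_add_one h, pow_succ, mul_comm]

theorem exp_half_le_one_add {t : ℝ} (h0 : 0 ≤ t) (h1 : t ≤ 1) : Real.exp (t / 2) ≤ 1 + t := by
  have h := Real.one_sub_le_exp_neg (t / 2)
  have hp := Real.exp_pos (t / 2)
  have hm : Real.exp (t / 2) * Real.exp (-(t / 2)) = 1 := by rw [← Real.exp_add]; simp
  nlinarith

open Filter Topology in
/-- The bound on the root tends to zero. -/
theorem tendsto_log_div_rpow {a : ℝ} (ha : 0 < a) :
    Tendsto (fun n : ℕ => (Real.log n / (n : ℝ)) ^ a) atTop (𝓝 0) := by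
  have h1 : Tendsto (fun n : ℕ => Real.log n / (n : ℝ)) atTop (𝓝 0) :=
    (Real.isLittleO_log_id_atTop.tendsto_div_nhds_zero).comp tendsto_natCast_atTop_atTop
  have h2 := h1.rpow_const (Or.inr ha.le)
  rwa [Real.zero_rpow ha.ne'] at h2

/-- The star polynomial is nonpositive at `-x` as soon as `x` is at least twice
`(log d / d) ^ (1 / m)`. -/
theorem star_poly_neg_nonpos {m d : ℕ} (hm : 3 ≤ m) (hodd : Odd m) (hd : 3 ≤ d) {y : ℝ}
    (hy : y = (Real.log d / (d : ℝ)) ^ ((1 : ℝ) / m)) (hy4 : 2 * y < 1) :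
    (1 + -(2 * y)) ^ (m * d)
      + -(2 * y) * ((1 + -(2 * y)) ^ m - (-(2 * y)) ^ m) ^ d ≤ 0 := by
  have hd' : (3 : ℝ) ≤ d := by exact_mod_cast hd
  have hd0 : (0 : ℝ) < d := by linarith
  have hlog : 1 ≤ Real.log d := by
    rw [Real.le_log_iff_exp_le hd0]
    linarith [Real.exp_one_lt_d9]
  have hm0 : (0 : ℝ) < m := by exact_mod_cast (by omega : 0 < m)
  have hq : 0 < Real.log d / (d : ℝ) := by positivity
  have hy0 : 0 < y := hy ▸ Real.rpow_pos_of_pos hq _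
  have hym : y ^ m = Real.log d / (d : ℝ) := by
    rw [hy, one_div]
    exact Real.rpow_inv_natCast_pow hq.le (by omega)
  have hyd : 1 ≤ y * d := by
    have h1 : y ^ m ≤ y := pow_le_of_le_one hy0.le (by linarith) (by omega)
    rw [hym, div_le_iff₀ hd0] at h1
    linarith
  set x := 2 * y with hx
  have hx0 : 0 < x := by positivity
  have hu : 0 < 1 - x := by linarith
  have hxm1 : x ^ m ≤ 1 := pow_le_one₀ hx0.le hy4.le
  have hxm : 2 * (Real.log d / d) ≤ x ^ m := by
    rw [hx, mul_pow, hym]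
    have : (2 : ℝ) ^ 1 ≤ 2 ^ m := pow_le_pow_right₀ (by norm_num) (by omega)
    nlinarith
  have hpow : (d : ℝ) ≤ (1 + x ^ m) ^ d := by
    calc (d : ℝ) = Real.exp (Real.log d) := (Real.exp_log hd0).symm
      _ ≤ Real.exp (d * (x ^ m / 2)) := by
          apply Real.exp_le_exp.2
          have h := mul_le_mul_of_nonneg_left hxm hd0.le
          have h2 : (d : ℝ) * (2 * (Real.log d / d)) = 2 * Real.log d := by field_simp
          linarith
      _ = Real.exp (x ^ m / 2) ^ d := Real.exp_nat_mul _ _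
      _ ≤ (1 + x ^ m) ^ d :=
          pow_le_pow_left₀ (Real.exp_pos _).le (exp_half_le_one_add (by positivity) hxm1) _
  have hum : 0 < (1 - x) ^ m := by positivity
  have hbase : (1 - x) ^ m * (1 + x ^ m) ≤ (1 - x) ^ m + x ^ m := by
    have : (1 - x) ^ m ≤ 1 := pow_le_one₀ hu.le (by linarith)
    nlinarith [pow_pos hx0 m]
  have hmain : (1 - x) ^ (m * d) * (1 + x ^ m) ^ d ≤ ((1 - x) ^ m + x ^ m) ^ d := by
    rw [pow_mul, ← mul_pow]
    exact pow_le_pow_left₀ (by positivity) hbase _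
  have hone : 1 ≤ x * (1 + x ^ m) ^ d := by
    have := mul_le_mul_of_nonneg_left hpow hx0.le
    nlinarith
  have hU : 0 < (1 - x) ^ (m * d) := by positivity
  rw [hodd.neg_pow, ← sub_eq_add_neg, sub_neg_eq_add]
  nlinarith [mul_le_mul_of_nonneg_left hmain hx0.le, mul_le_mul_of_nonneg_left hone hU.le]

/-- For every even `k ≥ 4` there exist `C > 0` and `Δ₀` such that for every
`Δ ≥ Δ₀`, the independence polynomial of the `k`-uniform star `S^k_Δ`
(the hypergraph on `1 + (k−1)Δ` vertices whose `Δ` edges each have `k` vertices,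
all contain one common vertex `c`, and pairwise intersect exactly in `c`)
has a real zero `λ` with `|λ| ≤ C·((log Δ)/Δ)^{1/(k−1)}`. -/
theorem star_has_small_root
    (k : ℕ) (hk : 4 ≤ k) (heven : Even k) :
    ∃ C : ℝ, 0 < C ∧ ∃ Δ₀ : ℕ, ∀ Δ : ℕ, Δ₀ ≤ Δ →
      ∀ (V : Type) [Fintype V] [DecidableEq V] (E : Finset (Finset V)),
        Fintype.card V = 1 + (k - 1) * Δ →
        E.card = Δ →
        (∀ e ∈ E, e.card = k) →
        (∃ c : V, (∀ e ∈ E, c ∈ e) ∧ ∀ e ∈ E, ∀ f ∈ E, e ≠ f → e ∩ f = {c}) →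
        ∃ lam : ℝ, indepPolyR E lam = 0 ∧
          |lam| ≤ C * (Real.log Δ / (Δ : ℝ)) ^ ((1 : ℝ) / ((k : ℝ) - 1)) := by
  have hk1 : ((k : ℝ) - 1) = ((k - 1 : ℕ) : ℝ) := by
    rw [Nat.cast_sub (by omega), Nat.cast_one]
  have hodd : Odd (k - 1) := Nat.Even.sub_odd (by omega) heven odd_one
  have hpos : (0 : ℝ) < 1 / ((k - 1 : ℕ) : ℝ) := by
    have : (0 : ℝ) < ((k - 1 : ℕ) : ℝ) := by exact_mod_cast (by omega : 0 < k - 1)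
    positivity
  obtain ⟨N, hN⟩ := Filter.eventually_atTop.1
    ((tendsto_log_div_rpow hpos).eventually_lt_const (by norm_num : (0 : ℝ) < 1 / 2))
  refine ⟨2, two_pos, max N 3, fun Δ hΔ V _ _ E hV hEc hcard ⟨c, hc, hE⟩ => ?_⟩
  rw [hk1]
  set y := (Real.log Δ / (Δ : ℝ)) ^ ((1 : ℝ) / ((k - 1 : ℕ) : ℝ)) with hy
  have hy0 : 0 ≤ y := Real.rpow_nonneg (div_nonneg (Real.log_natCast_nonneg _) (Nat.cast_nonneg _)) _
  have hy1 : y < 1 / 2 := hN Δ (le_trans (le_max_left _ _) hΔ)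
  have hΔ3 : 3 ≤ Δ := le_trans (le_max_right _ _) hΔ
  have hform := indepPolyR_star E (k - 1) c (by rw [hV, hEc])
    (fun e he => by rw [hcard e he]; omega) hc hE
  rw [hEc] at hform
  have hneg : indepPolyR E (-(2 * y)) ≤ 0 := by
    rw [hform]
    exact star_poly_neg_nonpos (by omega) hodd hΔ3 hy (by linarith)
  have hzero : 0 ≤ indepPolyR E 0 := by simp [hform]
  have hcont : ContinuousOn (indepPolyR E) (Set.Icc (-(2 * y)) 0) := by
    unfold indepPolyR
    fun_prop
  obtain ⟨lam, hlam, h0⟩ := intermediate_value_Icc (by linarith) hcont ⟨hneg, hzero⟩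
  exact ⟨lam, h0, abs_le.2 ⟨hlam.1, hlam.2.trans (by positivity)⟩⟩
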